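/- arXiv:1509.01371 — 2 statements merged into one kernel-verified Lean document; each statement's English description precedes it below -/
import Mathlib

section
/- Let m be even, a ∈ F_r^* with Tr(a^{-1}) = 0, and ρ ∈ F_p^*. Then the triple exponential sum Σ_{z ∈ F_p^*} Σ_{y ∈ F_p} Σ_{x ∈ F_r} ζ_p^{Tr(azx² + yx) − zρ} equals (-1)^{((p-1)/2)·(m/2)} · η(a) · p^{(m+2)/2} (as a complex number). -/
/-- `ζ_p ^ c` for `c ∈ F_p`: `exp(2πi·c̃/p)` where `c̃` is the integer representative. -/
noncomputable def zetaP (p : ℕ) (c : ZMod p) : ℂ :=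
  Complex.exp (2 * Real.pi * Complex.I * (c.val : ℂ) / (p : ℂ))

open Finset

section QuadraticGaussSum

variable {F : Type*} [Field F] [Fintype F] [DecidableEq F]

/-- The complex quadratic Gauss sum of a finite field. -/
noncomputable def quadraticGaussSum (ψ : AddChar F ℂ) : ℂ :=
  gaussSum ((quadraticChar F).ringHomComp (Int.castRingHom ℂ)) ψ

lemma quadraticGaussSum_eq_sum (ψ : AddChar F ℂ) :
    quadraticGaussSum ψ = ∑ x, (quadraticChar F x : ℂ) * ψ x := by
  simp [quadraticGaussSum, gaussSum]

lemma sum_quadraticChar_mul_addChar_mul (ψ : AddChar F ℂ) {b : F} (hb : b ≠ 0) :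
    ∑ x, (quadraticChar F x : ℂ) * ψ (b * x) = quadraticChar F b * quadraticGaussSum ψ := by
  rw [quadraticGaussSum_eq_sum,
    ← Equiv.sum_comp (Equiv.mulLeft₀ b hb) fun x ↦ (quadraticChar F x : ℂ) * ψ x, mul_sum]
  refine sum_congr rfl fun x _ ↦ ?_
  have h : ((quadraticChar F b : ℤ) : ℂ) * (quadraticChar F b : ℤ) = 1 := by
    exact_mod_cast (by simpa [sq] using quadraticChar_sq_one hb)
  simp only [Equiv.mulLeft₀_apply, map_mul, Int.cast_mul]
  linear_combination -(quadraticChar F x : ℂ) * ψ (b * x) * h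

lemma sum_addChar_mul_sq (hF : ringChar F ≠ 2) {ψ : AddChar F ℂ} (hψ : ψ ≠ 1) {b : F}
    (hb : b ≠ 0) :
    ∑ x, ψ (b * x ^ 2) = quadraticChar F b * quadraticGaussSum ψ := by
  have hcard (t : F) : (#{x : F | x ^ 2 = t} : ℂ) = quadraticChar F t + 1 := by
    have h := quadraticChar_card_sqrts hF t
    rw [Set.toFinset_ofPred] at h
    exact_mod_cast h
  have h0 : ∑ t, ψ (b * t) = 0 :=
    AddChar.sum_eq_zero_of_ne_one (AddChar.IsPrimitive.of_ne_one hψ hb)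
  calc ∑ x, ψ (b * x ^ 2) = ∑ t, ∑ x with x ^ 2 = t, ψ (b * x ^ 2) :=
        (sum_fiberwise _ _ _).symm
    _ = ∑ t, ((quadraticChar F t : ℂ) + 1) * ψ (b * t) := by
        refine sum_congr rfl fun t _ ↦ ?_
        rw [← hcard, ← nsmul_eq_mul, ← sum_const]
        refine sum_congr rfl fun x hx ↦ ?_
        rw [(mem_filter.mp hx).2]
    _ = quadraticChar F b * quadraticGaussSum ψ := by
        simp_rw [add_mul, one_mul, sum_add_distrib]
        rw [h0, add_zero, sum_quadraticChar_mul_addChar_mul ψ hb]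

lemma sum_addChar_quadratic (hF : ringChar F ≠ 2) {ψ : AddChar F ℂ} (hψ : ψ ≠ 1) {b : F}
    (hb : b ≠ 0) (c : F) :
    ∑ x, ψ (b * x ^ 2 + c * x)
      = ψ (-(c ^ 2 / (4 * b))) * (quadraticChar F b * quadraticGaussSum ψ) := by
  have h2 : (2 : F) ≠ 0 := Ring.two_ne_zero hF
  have h4 : (4 : F) ≠ 0 := by
    rw [show (4 : F) = 2 * 2 by norm_num]
    exact mul_ne_zero h2 h2
  rw [← sum_addChar_mul_sq hF hψ hb, mul_sum, ← Equiv.sum_comp (Equiv.addRight (-(c / (2 * b))))]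
  refine sum_congr rfl fun x _ ↦ ?_
  rw [← AddChar.map_add_eq_mul]
  congr 1
  simp only [Equiv.coe_addRight]
  field_simp
  ring

end QuadraticGaussSum

section QuadraticExtension

variable {K F : Type*} [Field K] [Fintype K] [Field F] [Fintype F] [Algebra K F]

lemma card_eq_sq_of_finrank_eq_two (h : Module.finrank K F = 2) :
    Fintype.card F = Fintype.card K ^ 2 := by
  rw [Module.card_eq_pow_finrank (K := K), h]

lemma card_sq_div_two {q : ℕ} (hq : Odd q) : q ^ 2 / 2 = (q - 1) * ((q + 1) / 2) := by
  obtain ⟨k, rfl⟩ := hq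
  rw [show (2 * k + 1 + 1) / 2 = k + 1 by omega, show 2 * k + 1 - 1 = 2 * k by omega]
  have : (2 * k + 1) ^ 2 = 2 * (2 * k * (k + 1)) + 1 := by ring
  omega

lemma quadraticChar_of_pow_card_sub_one_eq [DecidableEq F] (hF : ringChar F ≠ 2)
    (h : Module.finrank K F = 2) {x : F} {s : ℤ} (hs : s = 1 ∨ s = -1) (hx : x ^ (Fintype.card K - 1) = s) :
    quadraticChar F x = s ^ ((Fintype.card K + 1) / 2) := by
  have hodd : Odd (Fintype.card K) := Nat.odd_iff.mpr <|
    FiniteField.odd_card_of_char_ne_two (by rwa [Algebra.ringChar_eq K F])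
  have key := quadraticChar_eq_pow_of_char_ne_two' hF x
  rw [card_eq_sq_of_finrank_eq_two h, card_sq_div_two hodd, pow_mul, hx] at key
  have hx0 : x ≠ 0 := by
    rintro rfl
    have : Fintype.card K - 1 ≠ 0 := by have := Fintype.one_lt_card (α := K); omega
    rw [zero_pow this] at hx
    rcases hs with rfl | rfl <;> simp at hx
  have hne : (-1 : F) ≠ 1 := Ring.neg_one_ne_one_of_char_ne_two hF
  have hs' : s ^ ((Fintype.card K + 1) / 2) = 1 ∨ s ^ ((Fintype.card K + 1) / 2) = -1 := by
    rcases hs with rfl | rfl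
    · simp
    · exact neg_one_pow_eq_or ℤ _
  rw [← Int.cast_pow] at key
  rcases hs' with e | e <;> rcases quadraticChar_dichotomy hx0 with e' | e' <;>
    rw [e, e'] at key <;> rw [e, e'] <;> push_cast at key
  · exact absurd key hne
  · exact absurd key.symm hne

lemma quadraticChar_algebraMap_of_finrank_eq_two [DecidableEq F] (hF : ringChar F ≠ 2)
    (h : Module.finrank K F = 2) {k : K} (hk : k ≠ 0) :
    quadraticChar F (algebraMap K F k) = 1 := by
  rw [quadraticChar_of_pow_card_sub_one_eq (K := K) hF h (Or.inl rfl), one_pow]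
  rw [← map_pow, FiniteField.pow_card_sub_one_eq_one k hk, map_one, Int.cast_one]

lemma quadraticChar_of_trace_eq_zero [DecidableEq F] (hF : ringChar F ≠ 2)
    (h : Module.finrank K F = 2) {x : F} (hx : x ≠ 0) (htr : Algebra.trace K F x = 0) :
    quadraticChar F x = (-1) ^ ((Fintype.card K + 1) / 2) := by
  refine quadraticChar_of_pow_card_sub_one_eq hF h (Or.inr rfl) ?_
  have hsum := FiniteField.algebraMap_trace_eq_sum_pow K F x
  rw [htr, h, map_zero, sum_range_succ, sum_range_one, pow_zero, pow_one, pow_one,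
    Nat.card_eq_fintype_card] at hsum
  have hpow : x ^ Fintype.card K = x ^ (Fintype.card K - 1) * x :=
    (pow_sub_one_mul Fintype.card_ne_zero x).symm
  apply mul_right_cancel₀ hx
  rw [← hpow]
  push_cast
  linear_combination -hsum

lemma card_trace_eq_zero [DecidableEq K] (h : Module.finrank K F = 2) :
    #{x : F | Algebra.trace K F x = 0} = Fintype.card K := by
  have hker : Module.finrank K (LinearMap.ker (Algebra.trace K F)) = 1 := by
    have := (Algebra.trace K F).finrank_range_add_finrank_ker
    rw [LinearMap.range_eq_top.mpr (Algebra.trace_surjective K F), finrank_top,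
      Module.finrank_self, h] at this
    omega
  have hcard : Nat.card (LinearMap.ker (Algebra.trace K F)) = Nat.card K ^ 1 := by
    rw [Module.natCard_eq_pow_finrank (K := K), hker]
  rw [pow_one, Nat.card_eq_fintype_card (α := K)] at hcard
  rw [← hcard, ← Fintype.card_subtype, ← Nat.card_eq_fintype_card]
  rfl

/-- The quadratic Gauss sum over a quadratic extension, with respect to a lifted character. -/
theorem quadraticGaussSum_comp_trace [DecidableEq K] [DecidableEq F] (hF : ringChar F ≠ 2)
    (h : Module.finrank K F = 2) {ψ : AddChar K ℂ} (hψ : ψ ≠ 1) {Ψ : AddChar F ℂ}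
    (hΨ : ∀ x, Ψ x = ψ (Algebra.trace K F x)) :
    quadraticGaussSum Ψ = (-1) ^ ((Fintype.card K + 1) / 2) * Fintype.card K := by
  set q := Fintype.card K with hq
  have hscale (k : K) (hk : k ≠ 0) :
      ∑ x, (quadraticChar F x : ℂ) * ψ (k * Algebra.trace K F x) = quadraticGaussSum Ψ := by
    have hk' : algebraMap K F k ≠ 0 := by simpa using hk
    have := sum_quadraticChar_mul_addChar_mul Ψ hk'
    rw [quadraticChar_algebraMap_of_finrank_eq_two hF h hk, Int.cast_one, one_mul] at this
    rw [← this]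
    refine sum_congr rfl fun x _ ↦ ?_
    rw [hΨ, ← Algebra.smul_def, map_smul, smul_eq_mul]
  have hzero : ∑ x : F, (quadraticChar F x : ℂ) = 0 := by
    exact_mod_cast quadraticChar_sum_zero hF
  have hleft : ∑ k : K, ∑ x, (quadraticChar F x : ℂ) * ψ (k * Algebra.trace K F x)
      = (q - 1) * quadraticGaussSum Ψ := by
    rw [← add_sum_erase _ _ (mem_univ (0 : K))]
    simp only [zero_mul, AddChar.map_zero_eq_one, mul_one, hzero, zero_add]
    rw [sum_congr rfl fun k hk ↦ hscale k (ne_of_mem_erase hk), sum_const,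
      card_erase_of_mem (mem_univ _), card_univ, nsmul_eq_mul, Nat.cast_sub Fintype.card_pos,
      Nat.cast_one]
  have hright : ∑ k : K, ∑ x, (quadraticChar F x : ℂ) * ψ (k * Algebra.trace K F x)
      = q * ((q - 1) * (-1) ^ ((q + 1) / 2)) := by
    rw [sum_comm]
    simp_rw [← mul_sum, AddChar.sum_mulShift _ (AddChar.IsPrimitive.of_ne_one hψ)]
    have h1 : ∑ x with Algebra.trace K F x = 0, (quadraticChar F x : ℂ)
        = (q - 1) * (-1) ^ ((q + 1) / 2) := by
      have h0 : (0 : F) ∈ ({x : F | Algebra.trace K F x = 0} : Finset F) := by simp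
      rw [← add_sum_erase _ _ h0, sum_congr rfl (g := fun _ ↦ (-1 : ℂ) ^ ((q + 1) / 2)),
        sum_const, card_erase_of_mem h0, card_trace_eq_zero h, nsmul_eq_mul,
        Nat.cast_sub Fintype.card_pos]
      · simp [hq]
      · intro x hx
        rw [quadraticChar_of_trace_eq_zero hF h (ne_of_mem_erase hx)
          (mem_filter.mp (mem_of_mem_erase hx)).2]
        push_cast
        rfl
    rw [← h1, mul_sum, sum_filter]
    refine sum_congr rfl fun x _ ↦ ?_
    split_ifs <;> simp [mul_comm, hq]
  have hq1 : (q : ℂ) - 1 ≠ 0 := by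
    rw [sub_ne_zero]
    exact_mod_cast (Fintype.one_lt_card (α := K)).ne'
  apply mul_left_cancel₀ hq1
  rw [← hleft, hright]
  ring

end QuadraticExtension

lemma neg_one_pow_half_succ_pow {p : ℕ} (hp : Odd p) (n : ℕ) :
    (-1 : ℂ) ^ ((p ^ n + 1) / 2) = -(-1) ^ ((p - 1) / 2 * n) := by
  obtain ⟨k, rfl⟩ := hp
  have hsub : (2 * k + 1 - 1) / 2 = k := by omega
  rw [hsub]
  induction n with
  | zero => simp
  | succ n ih =>
    obtain ⟨l, hl⟩ : Odd ((2 * k + 1) ^ n) := (odd_two_mul_add_one k).pow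
    rw [hl, show (2 * l + 1 + 1) / 2 = l + 1 by omega] at ih
    rw [pow_succ (2 * k + 1), hl,
      show ((2 * l + 1) * (2 * k + 1) + 1) / 2 = 2 * (l * k) + (l + 1) + k by
        have : (2 * l + 1) * (2 * k + 1) + 1 = 2 * (2 * (l * k) + (l + 1) + k) := by ring
        omega,
      pow_add, pow_add, ih, pow_mul, mul_add, pow_add]
    simp

section EvenDegree

variable {p : ℕ} [Fact p.Prime] {F : Type*} [Field F] [Algebra (ZMod p) F]

lemma ringChar_ne_two_of_zmod_algebra (hp2 : p ≠ 2) : ringChar F ≠ 2 := by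
  rwa [← Algebra.ringChar_eq (ZMod p) F, ZMod.ringChar_zmod_n]

variable [Fintype F]

lemma finrank_zmod_eq_of_card_eq_pow {m : ℕ} (hcard : Fintype.card F = p ^ m) :
    Module.finrank (ZMod p) F = m := by
  have h := Module.card_eq_pow_finrank (K := ZMod p) (V := F)
  rw [hcard, ZMod.card] at h
  exact (Nat.pow_right_injective (Fact.out : p.Prime).two_le h).symm

variable [DecidableEq F]

theorem quadraticGaussSum_comp_trace_zmod (hp2 : p ≠ 2) {n : ℕ} (hn : n ≠ 0)
    (hcard : Fintype.card F = p ^ (2 * n)) {ψ : AddChar (ZMod p) ℂ} (hψ : ψ ≠ 1)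
    {Ψ : AddChar F ℂ} (hΨ : ∀ x, Ψ x = ψ (Algebra.trace (ZMod p) F x)) :
    quadraticGaussSum Ψ = -(-1) ^ ((p - 1) / 2 * n) * p ^ n := by
  classical
  have hrank := finrank_zmod_eq_of_card_eq_pow hcard
  let K := GaloisField p n
  have hrankK : Module.finrank (ZMod p) K = n := GaloisField.finrank p hn
  obtain ⟨f⟩ := FiniteField.nonempty_algHom_of_finrank_dvd (F := ZMod p) (K := K) (L := F)
    (by rw [hrankK, hrank]; exact dvd_mul_left _ _)
  let _ : Algebra K F := f.toRingHom.toAlgebra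
  have _ : IsScalarTower (ZMod p) K F := IsScalarTower.of_algHom f
  let _ : Fintype K := Fintype.ofFinite K
  have hcardK : Fintype.card K = p ^ n := by
    rw [← Nat.card_eq_fintype_card, GaloisField.card p n hn]
  have hKF : Module.finrank K F = 2 := by
    have h := Module.finrank_mul_finrank (ZMod p) K F
    rw [hrankK, hrank, mul_comm 2 n] at h
    exact Nat.eq_of_mul_eq_mul_left (Nat.pos_of_ne_zero hn) h
  let ψK : AddChar K ℂ := ψ.compAddMonoidHom (Algebra.trace (ZMod p) K).toAddMonoidHom
  have hψK : ψK ≠ 1 := by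
    obtain ⟨c, hc⟩ := AddChar.ne_one_iff.mp hψ
    obtain ⟨k, rfl⟩ := Algebra.trace_surjective (ZMod p) K c
    exact AddChar.ne_one_iff.mpr ⟨k, hc⟩
  rw [quadraticGaussSum_comp_trace (K := K) (ringChar_ne_two_of_zmod_algebra (p := p) hp2) hKF hψK
    (fun x ↦ ?_), hcardK, neg_one_pow_half_succ_pow ((Fact.out : p.Prime).odd_of_ne_two hp2)]
  · push_cast
    rfl
  · rw [hΨ, ← Algebra.trace_trace (S := K)]
    rfl

lemma quadraticChar_algebraMap_zmod (hp2 : p ≠ 2) {n : ℕ}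
    (hcard : Fintype.card F = p ^ (2 * n)) {z : ZMod p} (hz : z ≠ 0) :
    quadraticChar F (algebraMap (ZMod p) F z) = 1 := by
  have hF := ringChar_ne_two_of_zmod_algebra (F := F) (p := p) hp2
  have hz' : algebraMap (ZMod p) F z ≠ 0 := by simpa using hz
  have hodd : Odd (p ^ n) := ((Fact.out : p.Prime).odd_of_ne_two hp2).pow
  obtain ⟨c, hc⟩ : p - 1 ∣ p ^ n - 1 := by simpa using Nat.sub_dvd_pow_sub_pow p 1 n
  rw [quadraticChar_eq_pow_of_char_ne_two hF hz', hcard, mul_comm 2 n, pow_mul,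
    card_sq_div_two hodd, hc, mul_assoc, pow_mul, ← map_pow, ZMod.pow_card_sub_one_eq_one hz,
    map_one, one_pow, if_pos rfl]

end EvenDegree

lemma zetaP_eq_stdAddChar (p : ℕ) [Fact p.Prime] (c : ZMod p) :
    zetaP p c = ZMod.stdAddChar c := by
  rw [ZMod.stdAddChar_apply, ZMod.toCircle_apply, zetaP]

theorem stmt_4 (p m : ℕ) [Fact p.Prime] (hp2 : p ≠ 2) (hm : 2 ≤ m) (hmeven : Even m)
    (F : Type) [Field F] [Fintype F] [DecidableEq F] [Algebra (ZMod p) F]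
    (hcard : Fintype.card F = p ^ m)
    (a : F) (ha : a ≠ 0) (hTra : Algebra.trace (ZMod p) F a⁻¹ = 0)
    (ρ : ZMod p) (hρ : ρ ≠ 0) :
    (∑ z ∈ Finset.univ.filter (fun z : ZMod p => z ≠ 0), ∑ y : ZMod p, ∑ x : F,
        zetaP p (Algebra.trace (ZMod p) F
          (a * algebraMap (ZMod p) F z * x ^ 2 + algebraMap (ZMod p) F y * x) - z * ρ))
      = (((-1) ^ (((p - 1) / 2) * (m / 2)) * quadraticChar F a * (p : ℤ) ^ ((m + 2) / 2) : ℤ) : ℂ) := by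
  classical
  obtain ⟨n, rfl⟩ := hmeven.two_dvd
  have hn : n ≠ 0 := by omega
  have hF := ringChar_ne_two_of_zmod_algebra (F := F) hp2
  let ψ : AddChar (ZMod p) ℂ := ZMod.stdAddChar
  have hψp : ψ.IsPrimitive := ZMod.isPrimitive_stdAddChar p
  have hψ : ψ ≠ 1 := by simpa using hψp one_ne_zero
  let Ψ : AddChar F ℂ := ψ.compAddMonoidHom (Algebra.trace (ZMod p) F).toAddMonoidHom
  have hΨψ (x : F) : Ψ x = ψ (Algebra.trace (ZMod p) F x) := rfl
  have hΨ : Ψ ≠ 1 := by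
    obtain ⟨c, hc⟩ := AddChar.ne_one_iff.mp hψ
    obtain ⟨x, rfl⟩ := Algebra.trace_surjective (ZMod p) F c
    exact AddChar.ne_one_iff.mpr ⟨x, hc⟩
  have hinner (z : ZMod p) (hz : z ≠ 0) (y : ZMod p) :
      ∑ x : F, zetaP p (Algebra.trace (ZMod p) F
        (a * algebraMap (ZMod p) F z * x ^ 2 + algebraMap (ZMod p) F y * x) - z * ρ)
      = ψ (z * -ρ) * (quadraticChar F a * quadraticGaussSum Ψ) := by
    have hb : a * algebraMap (ZMod p) F z ≠ 0 := mul_ne_zero ha (by simpa using hz)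
    have htr : Algebra.trace (ZMod p) F
        (-(algebraMap (ZMod p) F y ^ 2 / (4 * (a * algebraMap (ZMod p) F z)))) = 0 := by
      have : -(algebraMap (ZMod p) F y ^ 2 / (4 * (a * algebraMap (ZMod p) F z)))
          = (-(y ^ 2 / (4 * z))) • a⁻¹ := by
        rw [Algebra.smul_def]
        simp only [map_neg, map_pow, map_mul, map_inv₀, map_ofNat, div_eq_mul_inv, mul_inv]
        ring
      rw [this, map_smul, hTra, smul_zero]
    have hsum := sum_addChar_quadratic hF hΨ hb (algebraMap (ZMod p) F y)
    rw [hΨψ (-_), htr, AddChar.map_zero_eq_one, one_mul, map_mul,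
      quadraticChar_algebraMap_zmod hp2 hcard hz, mul_one] at hsum
    rw [← hsum, mul_sum]
    refine sum_congr rfl fun x _ ↦ ?_
    rw [zetaP_eq_stdAddChar, hΨψ, ← AddChar.map_add_eq_mul]
    congr 1
    ring
  have houter : ∑ z ∈ univ.filter (fun z : ZMod p => z ≠ 0), ψ (z * -ρ) = -1 := by
    have h := AddChar.sum_mulShift (-ρ) hψp
    rw [if_neg (neg_ne_zero.mpr hρ), Nat.cast_zero, ← add_sum_erase _ _ (mem_univ 0), zero_mul,
      AddChar.map_zero_eq_one] at h
    rw [filter_ne' univ (0 : ZMod p)]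
    linear_combination h
  rw [sum_congr rfl fun z hz ↦ sum_congr rfl fun y _ ↦ hinner z (mem_filter.mp hz).2 y]
  simp_rw [sum_const, card_univ, ZMod.card, nsmul_eq_mul]
  rw [← mul_sum, ← sum_mul, houter, quadraticGaussSum_comp_trace_zmod hp2 hn hcard hψ hΨψ,
    show 2 * n / 2 = n by omega, show (2 * n + 2) / 2 = n + 1 by omega]
  push_cast
  ring
end

section
/- Let m be even and set ε = (-1)^{((p-1)/2)·(m/2)}. Then #{a ∈ F_r^* : η(a) = 1 and Tr(a^{-1}) = 0} = (p^{m-1} − 1 − ε(p−1)p^{(m-2)/2})/2 and #{a ∈ F_r^* : η(a) = -1 and Tr(a^{-1}) = 0} = (p^{m-1} − 1 + ε(p−1)p^{(m-2)/2})/2. -/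
open Finset in
theorem LinearMap.card_mul_card_filter_eq_zero {K V : Type*} [Field K] [Fintype K] [DecidableEq K]
    [AddCommGroup V] [Module K V] [Fintype V] {f : V →ₗ[K] K} (hf : f ≠ 0) :
    Fintype.card K * #{v | f v = 0} = Fintype.card V := by
  have h := f.finrank_range_add_finrank_ker
  rw [LinearMap.range_eq_top.2 (LinearMap.surjective hf), finrank_top, Module.finrank_self] at h
  have hker : #{v | f v = 0} = Nat.card (LinearMap.ker f) := by
    rw [← Fintype.card_subtype, ← Nat.card_eq_fintype_card]
    rfl
  rw [hker, Module.natCard_eq_pow_finrank (K := K), Module.card_eq_pow_finrank (K := K) (V := V),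
    ← h, pow_add, pow_one, Nat.card_eq_fintype_card]

section QuadraticExtension

variable {L K : Type*} [Field L] [Fintype L] [Field K] [Fintype K] [Algebra L K]

theorem card_div_two_of_finrank_eq_two (hK : ringChar K ≠ 2) (h2 : Module.finrank L K = 2) :
    Fintype.card K / 2 = (Fintype.card L - 1) * ((Fintype.card L + 1) / 2) ∧
      Odd (Fintype.card L) := by
  have hc : Fintype.card K = Fintype.card L ^ 2 := by
    rw [Module.card_eq_pow_finrank (K := L) (V := K), h2]
  have hodd : Odd (Fintype.card L) := by
    have h := FiniteField.odd_card_of_char_ne_two hK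
    rw [← Nat.odd_iff, hc] at h
    exact (Nat.odd_pow_iff two_ne_zero).1 h
  refine ⟨?_, hodd⟩
  obtain ⟨k, hk⟩ := hodd
  rw [hc, hk, show 2 * k + 1 - 1 = 2 * k by omega, show (2 * k + 1 + 1) / 2 = k + 1 by omega]
  have : (2 * k + 1) ^ 2 = 2 * (2 * k * (k + 1)) + 1 := by ring
  omega

variable [DecidableEq K]

theorem quadraticChar_algebraMap_of_finrank_eq_two_s9 (hK : ringChar K ≠ 2)
    (h2 : Module.finrank L K = 2) {c : L} (hc : c ≠ 0) :
    quadraticChar K (algebraMap L K c) = 1 := by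
  rw [quadraticChar_eq_pow_of_char_ne_two hK (by simpa using hc),
    (card_div_two_of_finrank_eq_two hK h2).1, ← map_pow, pow_mul,
    FiniteField.pow_card_sub_one_eq_one c hc]
  simp

theorem quadraticChar_of_trace_eq_zero_s9 (hK : ringChar K ≠ 2)
    (h2 : Module.finrank L K = 2) {a : K} (ha : a ≠ 0) (ht : Algebra.trace L K a = 0) :
    quadraticChar K a = (-1) ^ ((Fintype.card L + 1) / 2) := by
  have hs := FiniteField.algebraMap_trace_eq_sum_pow L K a
  rw [ht, h2, Finset.sum_range_succ, Finset.sum_range_one, map_zero, pow_zero, pow_one, pow_one,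
    Nat.card_eq_fintype_card] at hs
  have hq : a ^ (Fintype.card L - 1) = -1 := by
    apply mul_right_cancel₀ ha
    rw [← pow_succ, Nat.sub_add_cancel Fintype.card_pos]
    linear_combination -hs
  rw [quadraticChar_eq_pow_of_char_ne_two hK ha, (card_div_two_of_finrank_eq_two hK h2).1, pow_mul,
    hq]
  rcases neg_one_pow_eq_or ℤ ((Fintype.card L + 1) / 2) with h | h
  · rw [h, if_pos]
    exact ((neg_one_pow_eq_one_iff_even (Ring.neg_one_ne_one_of_char_ne_two hK)).2
      ((neg_one_pow_eq_one_iff_even (by decide)).1 h))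
  · rw [h, if_neg]
    rw [neg_one_pow_eq_one_iff_even (Ring.neg_one_ne_one_of_char_ne_two hK)]
    rw [neg_one_pow_eq_neg_one_iff_odd (by decide)] at h
    exact Nat.not_even_iff_odd.2 h

open Finset in
theorem sum_quadraticChar_of_trace_eq_zero_of_finrank_eq_two [DecidableEq L] (hK : ringChar K ≠ 2)
    (h2 : Module.finrank L K = 2) :
    ∑ a : K with Algebra.trace L K a = 0, quadraticChar K a =
      ((Fintype.card L : ℤ) - 1) * (-1) ^ ((Fintype.card L + 1) / 2) := by
  have hcard : #{a : K | Algebra.trace L K a = 0} = Fintype.card L := by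
    have h := LinearMap.card_mul_card_filter_eq_zero (Algebra.trace_ne_zero L K)
    rw [Module.card_eq_pow_finrank (K := L) (V := K), h2, sq] at h
    exact Nat.eq_of_mul_eq_mul_left Fintype.card_pos h
  have h0 : (0 : K) ∈ ({a : K | Algebra.trace L K a = 0} : Finset K) := by simp
  rw [← Finset.add_sum_erase _ _ h0, MulChar.map_zero, zero_add,
    Finset.sum_congr rfl (g := fun _ ↦ (-1) ^ ((Fintype.card L + 1) / 2))
      (fun a ha ↦ quadraticChar_of_trace_eq_zero_s9 hK h2 (by simp_all) (by simp_all)),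
    Finset.sum_const, card_erase_of_mem h0, hcard, nsmul_eq_mul, Nat.cast_pred Fintype.card_pos]

open Finset in
/-- The values of the quadratic character of `K`, summed over the trace-zero elements of `K` over
`k`, when `K` is a quadratic extension of an intermediate field `L`. -/
theorem card_mul_sum_quadraticChar_of_trace_eq_zero {k : Type*} [Field k] [Fintype k]
    [DecidableEq k] [Algebra k L] [Algebra k K] [IsScalarTower k L K] (hK : ringChar K ≠ 2)
    (h2 : Module.finrank L K = 2) :
    (Fintype.card k : ℤ) * ∑ a : K with Algebra.trace k K a = 0, quadraticChar K a =
      ((Fintype.card k : ℤ) - 1) * Fintype.card L * (-1) ^ ((Fintype.card L + 1) / 2) := by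
  classical
  set S := ∑ a : K with Algebra.trace k K a = 0, quadraticChar K a
  set q : ℤ := (Fintype.card L : ℤ) with hq
  set s : ℤ := (-1) ^ ((Fintype.card L + 1) / 2)
  have hq1 : q - 1 ≠ 0 := by
    have : 1 < Fintype.card L := Fintype.one_lt_card
    omega
  have hrow (c : L) : ∑ a : K with Algebra.trace k K (algebraMap L K c * a) = 0,
      quadraticChar K a = if c = 0 then 0 else S := by
    split_ifs with hc
    · simpa [hc, -quadraticChar_apply] using quadraticChar_sum_zero hK
    · have hc' : algebraMap L K c ≠ 0 := by simpa using hc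
      refine Finset.sum_equiv (Equiv.mulLeft₀ _ hc') (by simp) fun a _ ↦ ?_
      simp [-quadraticChar_apply, quadraticChar_algebraMap_of_finrank_eq_two_s9 hK h2 hc]
  have hcol (a : K) : (Fintype.card k : ℤ) *
      #{c : L | Algebra.trace k K (algebraMap L K c * a) = 0} =
        q + if Algebra.trace L K a = 0 then (Fintype.card k - 1) * q else 0 := by
    have htr (c : L) : Algebra.trace k K (algebraMap L K c * a) =
        Algebra.trace k L (Algebra.trace L K a * c) := by
      rw [← Algebra.trace_trace (S := L), ← Algebra.smul_def, map_smul, smul_eq_mul, mul_comm]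
    simp_rw [htr]
    split_ifs with ha
    · simp [ha, hq]
      ring
    · have hne : Algebra.trace k L ∘ₗ LinearMap.mulLeft k (Algebra.trace L K a) ≠ 0 := by
        intro h
        obtain ⟨x, hx⟩ := Algebra.trace_surjective k L 1
        have := LinearMap.congr_fun h ((Algebra.trace L K a)⁻¹ * x)
        simp [mul_inv_cancel_left₀ ha, hx] at this
      rw [add_zero, hq, ← LinearMap.card_mul_card_filter_eq_zero hne, Nat.cast_mul]
      congr 2
  have hcomm : ∑ c : L, ∑ a : K with Algebra.trace k K (algebraMap L K c * a) = 0,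
      quadraticChar K a =
      ∑ a : K, (#{c : L | Algebra.trace k K (algebraMap L K c * a) = 0} : ℤ) *
        quadraticChar K a := by
    simp_rw [Finset.sum_filter]
    rw [Finset.sum_comm]
    simp_rw [← Finset.sum_filter, Finset.sum_const, nsmul_eq_mul]
  have hleft : ∑ c : L, (if c = 0 then 0 else S) = (q - 1) * S := by
    rw [← Finset.add_sum_erase _ _ (Finset.mem_univ (0 : L)),
      Finset.sum_congr rfl (g := fun _ ↦ S) (fun c hc ↦ by simp_all), Finset.sum_const,
      card_erase_of_mem (Finset.mem_univ _), nsmul_eq_mul, Finset.card_univ,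
      Nat.cast_pred Fintype.card_pos]
    simp [hq]
  simp_rw [hrow] at hcomm
  rw [hleft] at hcomm
  have hright : (Fintype.card k : ℤ) * ((q - 1) * S) =
      (Fintype.card k - 1) * q * ((q - 1) * s) := by
    rw [hcomm, Finset.mul_sum]
    simp_rw [← mul_assoc, hcol, add_mul, ite_mul, zero_mul]
    rw [Finset.sum_add_distrib, ← Finset.mul_sum, quadraticChar_sum_zero hK, mul_zero, zero_add,
      ← Finset.sum_filter, ← Finset.mul_sum,
      sum_quadraticChar_of_trace_eq_zero_of_finrank_eq_two hK h2]
    ring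
  apply mul_left_cancel₀ hq1
  linear_combination hright

end QuadraticExtension

theorem neg_one_pow_half_pow_add_one {p : ℕ} (hp : Odd p) (n : ℕ) :
    (-1 : ℤ) ^ ((p ^ n + 1) / 2) = -(-1) ^ ((p - 1) / 2 * n) := by
  obtain ⟨k, rfl⟩ := hp
  have key : ∃ j, (2 * k + 1) ^ n = 2 * j + 1 ∧ (-1 : ℤ) ^ j = (-1) ^ (k * n) := by
    induction n with
    | zero => exact ⟨0, by simp⟩
    | succ n ih =>
      obtain ⟨j, hj, h⟩ := ih
      refine ⟨2 * (j * k) + j + k, by rw [pow_succ, hj]; ring, ?_⟩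
      rw [pow_add, pow_add, pow_mul, h, mul_add, pow_add]
      simp
  obtain ⟨j, hj, h⟩ := key
  rw [hj, show (2 * j + 1 + 1) / 2 = j + 1 by omega, show (2 * k + 1 - 1) / 2 = k by omega, pow_succ,
    h]
  ring

open Finset in
theorem ncard_quadraticChar_eq_trace_inv_eq_zero {k K : Type*} [Field k] [Field K]
    [DecidableEq k] [Fintype K] [DecidableEq K] [Algebra k K] (e : ℤ) :
    {a : K | a ≠ 0 ∧ quadraticChar K a = e ∧ Algebra.trace k K a⁻¹ = 0}.ncard =
      #{a : K | a ≠ 0 ∧ quadraticChar K a = e ∧ Algebra.trace k K a = 0} := by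
  have hinv (a : K) : quadraticChar K a⁻¹ = quadraticChar K a := by
    rw [← MulChar.inv_apply', (quadraticChar_isQuadratic K).inv]
  rw [← Set.ncard_coe_finset]
  refine Set.ncard_congr (fun a _ ↦ a⁻¹) ?_ (fun a b _ _ h ↦ inv_injective h) ?_
  · rintro a ⟨h0, h1, h2⟩
    simpa only [coe_filter, mem_univ, true_and, Set.mem_ofPred_eq, hinv] using
      ⟨inv_ne_zero h0, h1, h2⟩
  · intro a ha
    simp only [coe_filter, mem_univ, true_and, Set.mem_ofPred_eq] at ha
    exact ⟨a⁻¹, ⟨inv_ne_zero ha.1, (hinv a).trans ha.2.1, by rw [inv_inv]; exact ha.2.2⟩,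
      inv_inv a⟩

open Finset in
theorem card_quadraticChar_add_card_and_sub_card {K : Type*} [Field K] [Fintype K]
    [DecidableEq K] {P : K → Prop} [DecidablePred P] (h0 : P 0) :
    (#{a : K | a ≠ 0 ∧ quadraticChar K a = 1 ∧ P a} : ℤ) +
        #{a : K | a ≠ 0 ∧ quadraticChar K a = -1 ∧ P a} = #{a : K | P a} - 1 ∧
      (#{a : K | a ≠ 0 ∧ quadraticChar K a = 1 ∧ P a} : ℤ) -
        #{a : K | a ≠ 0 ∧ quadraticChar K a = -1 ∧ P a} =
          ∑ a : K with P a, quadraticChar K a := by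
  constructor
  · have hone : ∑ a : K, (if a = 0 then 1 else 0 : ℤ) = 1 := by simp
    rw [eq_sub_iff_add_eq, ← hone]
    simp_rw [card_filter, Nat.cast_sum]
    rw [← sum_add_distrib, ← sum_add_distrib]
    refine sum_congr rfl fun a _ ↦ ?_
    by_cases ha : a = 0
    · simp [ha, h0]
    · by_cases hP : P a <;> rcases quadraticChar_dichotomy ha with h | h <;> simp only [h] <;>
        simp [ha, hP]
  · simp_rw [card_filter, Nat.cast_sum, sum_filter]
    rw [← sum_sub_distrib]
    refine sum_congr rfl fun a _ ↦ ?_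
    by_cases ha : a = 0
    · simp [ha]
    · by_cases hP : P a <;> rcases quadraticChar_dichotomy ha with h | h <;> simp only [h] <;>
        simp [ha, hP]

theorem stmt_9 (p m : ℕ) [Fact p.Prime] (hp2 : p ≠ 2) (hm : 2 ≤ m) (hmeven : Even m)
    (F : Type) [Field F] [Fintype F] [DecidableEq F] [Algebra (ZMod p) F]
    (hcard : Fintype.card F = p ^ m)
    (ε : ℤ) (hε : ε = (-1) ^ (((p - 1) / 2) * (m / 2))) :
    2 * (({a : F | a ≠ 0 ∧ quadraticChar F a = 1 ∧
          Algebra.trace (ZMod p) F a⁻¹ = 0}).ncard : ℤ)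
        = (p : ℤ) ^ (m - 1) - 1 - ε * ((p : ℤ) - 1) * (p : ℤ) ^ ((m - 2) / 2) ∧
    2 * (({a : F | a ≠ 0 ∧ quadraticChar F a = -1 ∧
          Algebra.trace (ZMod p) F a⁻¹ = 0}).ncard : ℤ)
        = (p : ℤ) ^ (m - 1) - 1 + ε * ((p : ℤ) - 1) * (p : ℤ) ^ ((m - 2) / 2) := by
  obtain ⟨n, rfl⟩ := hmeven
  have hn : n ≠ 0 := by omega
  have hp : p.Prime := Fact.out
  have hp0 : (p : ℤ) ≠ 0 := by exact_mod_cast hp.ne_zero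
  have : CharP F p := charP_of_injective_algebraMap (algebraMap (ZMod p) F).injective p
  have hF : ringChar F ≠ 2 := by rwa [ringChar.eq F p]
  have hrank : Module.finrank (ZMod p) F = n + n := by
    apply Nat.pow_right_injective hp.two_le
    simp only
    rw [FiniteField.pow_finrank_eq_card, hcard]
  have hrankL : Module.finrank (ZMod p) (GaloisField p n) = n := GaloisField.finrank p hn
  obtain ⟨f⟩ := FiniteField.nonempty_algHom_of_finrank_dvd (F := ZMod p) (K := GaloisField p n)
    (L := F) (by rw [hrank, hrankL]; exact ⟨2, by ring⟩)
  let _ : Algebra (GaloisField p n) F := f.toAlgebra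
  have : IsScalarTower (ZMod p) (GaloisField p n) F := IsScalarTower.of_algHom f
  let _ : Fintype (GaloisField p n) := Fintype.ofFinite _
  have h2 : Module.finrank (GaloisField p n) F = 2 := by
    have h := Module.finrank_mul_finrank (ZMod p) (GaloisField p n) F
    rw [hrank, hrankL, ← mul_two] at h
    exact Nat.eq_of_mul_eq_mul_left (Nat.pos_of_ne_zero hn) h
  have hcardL : Fintype.card (GaloisField p n) = p ^ n := by
    rw [← Nat.card_eq_fintype_card, GaloisField.card p n hn]
  have hS := card_mul_sum_quadraticChar_of_trace_eq_zero (k := ZMod p) hF h2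
  have hN := LinearMap.card_mul_card_filter_eq_zero (Algebra.trace_ne_zero (ZMod p) F)
  rw [hcardL, ZMod.card, neg_one_pow_half_pow_add_one (hp.odd_of_ne_two hp2)] at hS
  rw [ZMod.card, hcard] at hN
  rw [show (n + n) / 2 = n by omega] at hε
  rw [← hε] at hS
  obtain ⟨j, rfl⟩ := Nat.exists_eq_add_one_of_ne_zero hn
  have hN' : (Finset.card {a : F | Algebra.trace (ZMod p) F a = 0} : ℤ) = p ^ (2 * j + 1) := by
    apply mul_left_cancel₀ hp0
    rw [← pow_succ']
    exact_mod_cast hN.trans (by ring)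
  have hS' : ∑ a : F with Algebra.trace (ZMod p) F a = 0, quadraticChar F a =
      -(ε * ((p : ℤ) - 1) * p ^ j) := by
    apply mul_left_cancel₀ hp0
    rw [hS]
    push_cast
    ring
  obtain ⟨hadd, hsub⟩ := card_quadraticChar_add_card_and_sub_card
    (P := fun a : F ↦ Algebra.trace (ZMod p) F a = 0) (map_zero _)
  rw [hN'] at hadd
  rw [hS'] at hsub
  rw [ncard_quadraticChar_eq_trace_inv_eq_zero, ncard_quadraticChar_eq_trace_inv_eq_zero,
    show (j + 1) + (j + 1) - 1 = 2 * j + 1 by omega, show ((j + 1) + (j + 1) - 2) / 2 = j by omega]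
  constructor
  · linear_combination hadd + hsub
  · linear_combination hadd - hsub
end
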